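/- arXiv:0909.0694 — 2 statements merged into one kernel-verified Lean document; each statement's English description precedes it below -/
import Mathlib

section
/- For every n ≥ 1, the Eulerian polynomial identity of Foata–Schützenberger holds: Σ_{w ∈ S_n} t^{des(w)} = Σ_{w ∈ Pk_n} t^{des(w)} (1+t)^{n−1−2·des(w)} as polynomials in t (in particular, every w ∈ Pk_n satisfies 2·des(w) ≤ n−1). -/
open Polynomial Finset

attribute [local instance] Classical.propDecidable

/-- The value `w_i` of the permutation word `w = w_1 ⋯ w_n` of `[n] = {1,…,n}`
(one-indexed); by convention the value is `0` outside the range, so `w_0 = 0`. -/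
def pval (n : ℕ) (w : Equiv.Perm (Fin n)) (i : ℕ) : ℕ :=
  if h : 1 ≤ i ∧ i ≤ n then ((w ⟨i - 1, by omega⟩ : Fin n) : ℕ) + 1 else 0

/-- The descent set of `w`: positions `i ∈ [n-1]` with `w_i > w_{i+1}`. -/
def desSet (n : ℕ) (w : Equiv.Perm (Fin n)) : Finset ℕ :=
  (Finset.Icc 1 (n - 1)).filter fun i => pval n w (i + 1) < pval n w i

/-- The number of descents of `w`. -/
def des (n : ℕ) (w : Equiv.Perm (Fin n)) : ℕ := (desSet n w).card

/-- `w ∈ Pk_n`: `w` has no double descents (no `i` with `2 ≤ i ≤ n-1` and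
`w_{i-1} > w_i > w_{i+1}`) and no final descent (`¬(w_{n-1} > w_n)`). -/
def IsPk (n : ℕ) (w : Equiv.Perm (Fin n)) : Prop :=
  (∀ i ∈ Finset.Icc 2 (n - 1),
      ¬(pval n w i < pval n w (i - 1) ∧ pval n w (i + 1) < pval n w i)) ∧
  ¬(pval n w n < pval n w (n - 1))

namespace ListWord

/-- The number of descents of a word. -/
def descents : List ℕ → ℕ
  | [] => 0
  | [_] => 0
  | a :: b :: l => (if b < a then 1 else 0) + descents (b :: l)

/-- A word without double descents and without a final descent. -/
def NoDoubleDescent : List ℕ → Prop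
  | [] => True
  | [_] => True
  | [a, b] => ¬ b < a
  | a :: b :: c :: l => ¬ (b < a ∧ c < b) ∧ NoDoubleDescent (b :: c :: l)

/-- The words using each letter of `S` exactly once. -/
noncomputable def arrangements (S : Finset ℕ) : Finset (List ℕ) :=
  S.toList.permutations.toFinset

lemma mem_arrangements {S : Finset ℕ} {l : List ℕ} :
    l ∈ arrangements S ↔ l.Nodup ∧ ∀ x, x ∈ l ↔ x ∈ S := by
  rw [arrangements, List.mem_toFinset, List.mem_permutations]
  constructor
  · intro h
    exact ⟨h.nodup_iff.2 S.nodup_toList, fun x => by rw [h.mem_iff, Finset.mem_toList]⟩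
  · rintro ⟨h, h'⟩
    exact (List.perm_ext_iff_of_nodup h S.nodup_toList).2 fun x => by
      rw [h', Finset.mem_toList]

lemma card_arrangements (S : Finset ℕ) : (arrangements S).card = S.card.factorial := by
  rw [arrangements, List.toFinset_card_of_nodup (List.nodup_permutations _ S.nodup_toList),
    List.length_permutations, Finset.length_toList]

lemma descents_append_min (m : ℕ) (u v : List ℕ) (hu : ∀ x ∈ u, m < x) (hv : ∀ x ∈ v, m < x) :
    descents (u ++ m :: v) = descents u + descents v + if u = [] then 0 else 1 := by
  induction u with
  | nil =>
    cases v with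
    | nil => simp [descents]
    | cons y v => have := hv y (by simp); simp [descents, this.le]
  | cons x u ih =>
    have ih := ih fun y hy => hu y (by simp [hy])
    cases u with
    | nil => have := hu x (by simp); simp_all [descents]; omega
    | cons y u => simp_all [descents]; omega

lemma noDoubleDescent_append_min (m : ℕ) (u v : List ℕ)
    (hu : ∀ x ∈ u, m < x) (hv : ∀ x ∈ v, m < x) :
    NoDoubleDescent (u ++ m :: v) ↔
      NoDoubleDescent u ∧ NoDoubleDescent v ∧ (v = [] → u = []) := by
  induction u with
  | nil =>
    rcases v with _ | ⟨y, _ | ⟨z, v⟩⟩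
    · simp [NoDoubleDescent]
    · have := hv y (by simp); simp [NoDoubleDescent, this.le]
    · have := hv y (by simp); simp [NoDoubleDescent, this.not_gt]
  | cons x u ih =>
    have ih := ih fun y hy => hu y (by simp [hy])
    have hx := hu x (by simp)
    rcases u with _ | ⟨y, _ | ⟨z, u⟩⟩
    · rcases v with _ | ⟨y, v⟩
      · simp [NoDoubleDescent, hx]
      · have := hv y (by simp)
        simp_all [NoDoubleDescent, this.le]
    · have hy := hu y (by simp)
      simp_all [NoDoubleDescent]
    · simp_all [NoDoubleDescent]
      tauto

lemma two_mul_descents_lt_length : ∀ l : List ℕ, l ≠ [] → NoDoubleDescent l →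
    2 * descents l + 1 ≤ l.length
  | [], h, _ => absurd rfl h
  | [_], _, _ => by simp [descents]
  | [a, b], _, h => by
    have h : ¬ b < a := h
    simp [descents, h]
  | a :: b :: c :: l, _, h => by
    obtain ⟨h, h'⟩ := h
    have h1 := two_mul_descents_lt_length (b :: c :: l) (by simp) h'
    have h2 : NoDoubleDescent (c :: l) := by
      rcases l with _ | ⟨d, l⟩
      · trivial
      · exact h'.2
    have h3 := two_mul_descents_lt_length (c :: l) (by simp) h2
    simp only [descents, List.length_cons] at *
    split_ifs at * <;> omega

lemma sum_arrangements_insert {M : Type*} [AddCommMonoid M] (m : ℕ) (R : Finset ℕ) (hm : m ∉ R)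
    (F : List ℕ → M) :
    ∑ l ∈ arrangements (insert m R), F l =
      ∑ T ∈ R.powerset, ∑ u ∈ arrangements T, ∑ v ∈ arrangements (R \ T), F (u ++ m :: v) := by
  simp_rw [← Finset.sum_product']
  rw [Finset.sum_sigma']
  symm
  refine Finset.sum_bij (fun p _ => p.2.1 ++ m :: p.2.2) ?_ ?_ ?_ (fun _ _ => rfl)
  · rintro ⟨T, u, v⟩ h
    simp only [Finset.mem_sigma, Finset.mem_product, Finset.mem_powerset, mem_arrangements] at h ⊢
    obtain ⟨hT, ⟨hu, hu'⟩, hv, hv'⟩ := h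
    refine ⟨?_, ?_⟩
    · rw [List.nodup_append]
      grind
    · intro x
      have := @hT x
      grind
  · rintro ⟨T, u, v⟩ h ⟨T', u', v'⟩ h' e
    simp only [Finset.mem_sigma, Finset.mem_product, Finset.mem_powerset, mem_arrangements] at h h' e
    obtain ⟨hT, ⟨hu, hu'⟩, hv, hv'⟩ := h
    obtain ⟨kT, ⟨ku, ku'⟩, kv, kv'⟩ := h'
    have h1 : m ∉ u := fun h => hm (hT ((hu' m).1 h))
    have h2 : m ∉ u' := fun h => hm (kT ((ku' m).1 h))
    have h3 : u = u' ∧ v = v' := by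
      rw [List.append_eq_append_iff] at e
      rcases e with ⟨a, rfl, e⟩ | ⟨a, rfl, e⟩ <;> rcases a with _ | ⟨y, a⟩ <;> simp_all
    obtain ⟨rfl, rfl⟩ := h3
    have : T = T' := by ext x; rw [← hu', ku']
    subst this
    rfl
  · intro l hl
    rw [mem_arrangements] at hl
    obtain ⟨u, v, rfl⟩ := List.append_of_mem ((hl.2 m).2 (by simp))
    obtain ⟨h, h'⟩ := hl
    rw [List.nodup_append] at h
    refine ⟨⟨u.toFinset, u, v⟩, ?_, rfl⟩
    simp only [Finset.mem_sigma, Finset.mem_product, Finset.mem_powerset, mem_arrangements]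
    refine ⟨?_, ⟨h.1, by simp⟩, by grind, ?_⟩
    · intro x hx
      have := h' x
      rw [List.mem_toFinset] at hx
      grind
    · intro x
      have := h' x
      rw [Finset.mem_sdiff, List.mem_toFinset]
      grind

/-- The contribution of a word to the right-hand side of the identity. -/
noncomputable def peakWeight (l : List ℕ) : Polynomial ℤ :=
  if NoDoubleDescent l then X ^ descents l * (1 + X) ^ (l.length - 1 - 2 * descents l) else 0

lemma peakWeight_append_min (m : ℕ) (u v : List ℕ) (hu : ∀ x ∈ u, m < x) (hv : ∀ x ∈ v, m < x)
    (hu0 : u ≠ []) (hv0 : v ≠ []) :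
    peakWeight (u ++ m :: v) = X * (peakWeight u * peakWeight v) := by
  unfold peakWeight
  rw [descents_append_min m u v hu hv]
  simp only [noDoubleDescent_append_min m u v hu hv, hu0, hv0]
  by_cases h1 : NoDoubleDescent u
  · by_cases h2 : NoDoubleDescent v
    · have h3 := two_mul_descents_lt_length u hu0 h1
      have h4 := two_mul_descents_lt_length v hv0 h2
      have : (u ++ m :: v).length - 1 - 2 * (descents u + descents v + 1) =
          (u.length - 1 - 2 * descents u) + (v.length - 1 - 2 * descents v) := by
        simp only [List.length_append, List.length_cons]
        omega
      simp only [h1, h2, if_true, if_false, true_and, this, pow_add, pow_one, false_imp_iff]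
      ring
    · simp [h2]
  · simp [h1]

lemma peakWeight_cons_min (m : ℕ) (v : List ℕ) (hv : ∀ x ∈ v, m < x) (hv0 : v ≠ []) :
    peakWeight (m :: v) = (1 + X) * peakWeight v := by
  have h1 := descents_append_min m [] v (by simp) hv
  have h2 := noDoubleDescent_append_min m [] v (by simp) hv
  simp only [List.nil_append] at h1 h2
  unfold peakWeight
  rw [h1]
  simp only [h2]
  by_cases h : NoDoubleDescent v
  · have h4 := two_mul_descents_lt_length v hv0 h
    have : v.length - 2 * descents v = v.length - 1 - 2 * descents v + 1 := by
      omega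
    simp only [h, NoDoubleDescent, descents, List.length_cons, Nat.add_sub_cancel, zero_add,
      if_true, add_zero, implies_true, and_self, this]
    ring
  · simp [h]

lemma peakWeight_concat_min (m : ℕ) (u : List ℕ) (hu : ∀ x ∈ u, m < x) (hu0 : u ≠ []) :
    peakWeight (u ++ [m]) = 0 := by
  simp [peakWeight, noDoubleDescent_append_min m u [] hu (by simp), hu0]

lemma arrangements_empty : arrangements ∅ = {[]} := by
  simp [arrangements]

lemma ne_nil_of_mem_arrangements {S : Finset ℕ} {l : List ℕ} (hl : l ∈ arrangements S)
    (hS : S ≠ ∅) : l ≠ [] := by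
  rintro rfl
  obtain ⟨x, hx⟩ := Finset.nonempty_iff_ne_empty.2 hS
  simpa using ((mem_arrangements.1 hl).2 x).2 hx

theorem sum_X_pow_descents_eq_sum_peakWeight (S : Finset ℕ) (hS : S.Nonempty) :
    ∑ l ∈ arrangements S, (X : Polynomial ℤ) ^ descents l = ∑ l ∈ arrangements S, peakWeight l := by
  induction S using Finset.strongInduction with
  | H S ih =>
  obtain ⟨m, R, hm, rfl, hlt⟩ : ∃ m R, m ∉ R ∧ insert m R = S ∧ ∀ x ∈ R, m < x :=
    ⟨S.min' hS, S.erase (S.min' hS), by simp, Finset.insert_erase (S.min'_mem hS),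
      fun x hx => S.min'_lt_of_mem_erase_min' hS hx⟩
  rw [sum_arrangements_insert m R hm, sum_arrangements_insert m R hm]
  rcases R.eq_empty_or_nonempty with rfl | hR
  · simp [arrangements_empty, peakWeight, NoDoubleDescent, descents]
  have ih : ∀ T ⊆ R, T ≠ ∅ → ∑ l ∈ arrangements T, (X : Polynomial ℤ) ^ descents l =
      ∑ l ∈ arrangements T, peakWeight l := fun T hT hT0 =>
    ih T (Finset.ssubset_of_subset_of_ssubset hT (Finset.ssubset_insert hm))
      (Finset.nonempty_iff_ne_empty.2 hT0)
  have hlt' : ∀ T ⊆ R, ∀ u ∈ arrangements T, ∀ x ∈ u, m < x := fun T hT u hu x hx =>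
    hlt x (hT (((mem_arrangements.1 hu).2 x).1 hx))
  have hR0 : R ≠ ∅ := hR.ne_empty
  have hmem : R ∈ R.powerset := by simp
  have hmem' : ∅ ∈ R.powerset.erase R := by simp [hR0.symm]
  rw [← Finset.add_sum_erase _ _ hmem, ← Finset.add_sum_erase _ _ hmem,
    ← Finset.add_sum_erase _ _ hmem', ← Finset.add_sum_erase _ _ hmem', ← add_assoc, ← add_assoc]
  congr 1
  · simp only [Finset.sdiff_self, Finset.sdiff_empty, arrangements_empty, Finset.sum_singleton,
      List.nil_append]
    have e1 : ∑ u ∈ arrangements R, (X : Polynomial ℤ) ^ descents (u ++ [m]) =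
        X * ∑ u ∈ arrangements R, X ^ descents u := by
      rw [Finset.mul_sum]
      refine Finset.sum_congr rfl fun u hu => ?_
      rw [descents_append_min m u [] (hlt' R subset_rfl u hu) (by simp),
        if_neg (ne_nil_of_mem_arrangements hu hR0)]
      simp [descents, pow_succ, mul_comm]
    have e2 : ∑ v ∈ arrangements R, (X : Polynomial ℤ) ^ descents (m :: v) =
        ∑ v ∈ arrangements R, X ^ descents v := by
      refine Finset.sum_congr rfl fun v hv => ?_
      have := descents_append_min m [] v (by simp) (hlt' R subset_rfl v hv)
      simp only [List.nil_append] at this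
      simp [this, descents]
    have e3 : ∑ u ∈ arrangements R, peakWeight (u ++ [m]) = 0 :=
      Finset.sum_eq_zero fun u hu => peakWeight_concat_min m u (hlt' R subset_rfl u hu)
        (ne_nil_of_mem_arrangements hu hR0)
    have e4 : ∑ v ∈ arrangements R, peakWeight (m :: v) =
        (1 + X) * ∑ v ∈ arrangements R, peakWeight v := by
      rw [Finset.mul_sum]
      exact Finset.sum_congr rfl fun v hv => peakWeight_cons_min m v (hlt' R subset_rfl v hv)
        (ne_nil_of_mem_arrangements hv hR0)
    rw [e1, e2, e3, e4, ← ih R subset_rfl hR0]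
    ring
  · refine Finset.sum_congr rfl fun T hT => ?_
    simp only [Finset.mem_erase, Finset.mem_powerset] at hT
    obtain ⟨hT0, hTR, hT⟩ := hT
    have hd0 : R \ T ≠ ∅ := fun h => hTR (hT.antisymm (Finset.sdiff_eq_empty_iff_subset.1 h))
    have e1 : ∑ u ∈ arrangements T, ∑ v ∈ arrangements (R \ T),
        (X : Polynomial ℤ) ^ descents (u ++ m :: v) =
        X * ((∑ u ∈ arrangements T, X ^ descents u) *
          ∑ v ∈ arrangements (R \ T), X ^ descents v) := by
      rw [Finset.sum_mul_sum, Finset.mul_sum]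
      refine Finset.sum_congr rfl fun u hu => ?_
      rw [Finset.mul_sum]
      refine Finset.sum_congr rfl fun v hv => ?_
      rw [descents_append_min m u v (hlt' T hT u hu) (hlt' _ Finset.sdiff_subset v hv),
        if_neg (ne_nil_of_mem_arrangements hu hT0)]
      ring
    have e2 : ∑ u ∈ arrangements T, ∑ v ∈ arrangements (R \ T), peakWeight (u ++ m :: v) =
        X * ((∑ u ∈ arrangements T, peakWeight u) *
          ∑ v ∈ arrangements (R \ T), peakWeight v) := by
      rw [Finset.sum_mul_sum, Finset.mul_sum]
      refine Finset.sum_congr rfl fun u hu => ?_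
      rw [Finset.mul_sum]
      exact Finset.sum_congr rfl fun v hv => peakWeight_append_min m u v (hlt' T hT u hu)
        (hlt' _ Finset.sdiff_subset v hv) (ne_nil_of_mem_arrangements hu hT0)
        (ne_nil_of_mem_arrangements hv hd0)
    rw [e1, e2, ih T hT hT0, ih _ Finset.sdiff_subset hd0]

lemma descents_map_range' (f : ℕ → ℕ) (k a : ℕ) :
    descents ((List.range' a (k + 1)).map f) =
      ((Finset.Ico a (a + k)).filter fun i => f (i + 1) < f i).card := by
  induction k generalizing a with
  | zero => simp [descents]
  | succ k ih =>
    have h : Finset.Ico a (a + (k + 1)) = insert a (Finset.Ico (a + 1) (a + 1 + k)) := by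
      ext x
      simp only [Finset.mem_Ico, Finset.mem_insert]
      omega
    have ih := ih (a + 1)
    rw [List.range'_succ] at ih
    rw [h, Finset.filter_insert, List.range'_succ, List.range'_succ]
    simp only [List.map_cons, descents] at ih ⊢
    rw [ih]
    split_ifs
    · rw [Finset.card_insert_of_notMem (by simp), add_comm]
    · rw [zero_add]

lemma noDoubleDescent_map_range' (f : ℕ → ℕ) (k a : ℕ) :
    NoDoubleDescent ((List.range' a (k + 2)).map f) ↔
      (∀ i ∈ Finset.Ico a (a + k), ¬ (f (i + 1) < f i ∧ f (i + 2) < f (i + 1))) ∧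
        ¬ f (a + k + 1) < f (a + k) := by
  induction k generalizing a with
  | zero => simp [NoDoubleDescent, List.range'_succ]
  | succ k ih =>
    have h : Finset.Ico a (a + (k + 1)) = insert a (Finset.Ico (a + 1) (a + 1 + k)) := by
      ext x
      simp only [Finset.mem_Ico, Finset.mem_insert]
      omega
    have ih := ih (a + 1)
    rw [List.range'_succ, List.range'_succ] at ih
    rw [h, Finset.forall_mem_insert, List.range'_succ, List.range'_succ, List.range'_succ]
    simp only [List.map_cons, NoDoubleDescent] at ih ⊢
    rw [ih, and_assoc]
    have : a + (k + 1) = a + 1 + k := by omega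
    rw [this]

end ListWord

open ListWord

/-- The word `w_1 ⋯ w_n` as a list. -/
def permWord (n : ℕ) (w : Equiv.Perm (Fin n)) : List ℕ :=
  (List.range' 1 n).map (pval n w)

lemma length_permWord (n : ℕ) (w : Equiv.Perm (Fin n)) : (permWord n w).length = n := by
  simp [permWord]

lemma pval_succ (n : ℕ) (w : Equiv.Perm (Fin n)) (i : Fin n) : pval n w (i + 1) = w i + 1 := by
  have : 1 ≤ (i : ℕ) + 1 ∧ (i : ℕ) + 1 ≤ n := by omega
  simp [pval, this]

lemma permWord_injective (n : ℕ) : Function.Injective (permWord n) := by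
  intro w w' h
  ext i
  have := List.map_inj_left.1 h (i + 1) (by simp; omega)
  rw [pval_succ, pval_succ] at this
  omega

lemma permWord_mem_arrangements (n : ℕ) (w : Equiv.Perm (Fin n)) :
    permWord n w ∈ arrangements (Finset.Icc 1 n) := by
  have key : permWord n w = (List.finRange n).map fun i => (w i : ℕ) + 1 := by
    refine List.ext_getElem (by simp [permWord]) fun i h1 h2 => ?_
    have hi : i < n := by simpa [length_permWord] using h1
    have := pval_succ n w ⟨i, hi⟩
    simp_all [permWord, add_comm]
  rw [key, mem_arrangements]
  refine ⟨(List.nodup_finRange n).map fun i j h => w.injective (Fin.ext (by simpa using h)), ?_⟩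
  intro x
  simp only [List.mem_map, List.mem_finRange, true_and, Finset.mem_Icc]
  constructor
  · rintro ⟨i, rfl⟩
    omega
  · intro h
    exact ⟨w.symm ⟨x - 1, by omega⟩, by simp; omega⟩

lemma image_permWord (n : ℕ) :
    Finset.univ.image (permWord n) = arrangements (Finset.Icc 1 n) := by
  refine Finset.eq_of_subset_of_card_le ?_ ?_
  · intro l hl
    obtain ⟨w, -, rfl⟩ := Finset.mem_image.1 hl
    exact permWord_mem_arrangements n w
  · rw [card_arrangements, Finset.card_image_of_injective _ (permWord_injective n),
      Finset.card_univ, Fintype.card_perm]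
    simp

lemma descents_permWord (n : ℕ) (hn : 1 ≤ n) (w : Equiv.Perm (Fin n)) :
    descents (permWord n w) = des n w := by
  obtain ⟨k, rfl⟩ := Nat.exists_eq_add_of_le' hn
  rw [permWord, descents_map_range', des, desSet]
  congr 2
  ext x
  simp only [Finset.mem_Ico, Finset.mem_Icc]
  omega

lemma noDoubleDescent_permWord (n : ℕ) (hn : 1 ≤ n) (w : Equiv.Perm (Fin n)) :
    NoDoubleDescent (permWord n w) ↔ IsPk n w := by
  obtain rfl | hn := hn.eq_or_lt
  · simp [permWord, IsPk, NoDoubleDescent, pval]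
  obtain ⟨k, rfl⟩ := Nat.exists_eq_add_of_le' (show 2 ≤ n from hn)
  rw [permWord, noDoubleDescent_map_range', IsPk]
  have e : 1 + k + 1 = k + 2 := by omega
  have e' : 1 + k = k + 2 - 1 := by omega
  rw [e, e']
  refine and_congr ⟨fun h i hi => ?_, fun h i hi => ?_⟩ Iff.rfl
  · rw [Finset.mem_Icc] at hi
    have := h (i - 1) (by rw [Finset.mem_Ico]; omega)
    rwa [show i - 1 + 1 = i by omega, show i - 1 + 2 = i + 1 by omega] at this
  · rw [Finset.mem_Ico] at hi
    exact h (i + 1) (by rw [Finset.mem_Icc]; omega)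

/-- Foata–Schützenberger: `Σ_{w ∈ S_n} t^{des w} = Σ_{w ∈ Pk_n} t^{des w} (1+t)^{n-1-2 des w}`
(and every `w ∈ Pk_n` satisfies `2·des w ≤ n-1`). -/
theorem foata_schutzenberger (n : ℕ) (hn : 1 ≤ n) :
    (∀ w : Equiv.Perm (Fin n), IsPk n w → 2 * des n w ≤ n - 1) ∧
    (∑ w : Equiv.Perm (Fin n), (X : Polynomial ℤ) ^ des n w) =
      ∑ w ∈ Finset.univ.filter fun w : Equiv.Perm (Fin n) => IsPk n w,
        (X : Polynomial ℤ) ^ des n w * (1 + X) ^ (n - 1 - 2 * des n w) := by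
  refine ⟨fun w hw => ?_, ?_⟩
  · have hne : permWord n w ≠ [] := by
      rw [← List.length_pos_iff, length_permWord]
      omega
    have := two_mul_descents_lt_length _ hne ((noDoubleDescent_permWord n hn w).2 hw)
    rw [descents_permWord n hn, length_permWord] at this
    omega
  · have h := sum_X_pow_descents_eq_sum_peakWeight (Finset.Icc 1 n) (by simpa using hn)
    rw [← image_permWord, Finset.sum_image (permWord_injective n).injOn,
      Finset.sum_image (permWord_injective n).injOn] at h
    simpa only [peakWeight, descents_permWord n hn, noDoubleDescent_permWord n hn,
      length_permWord, Finset.sum_filter] using h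
end

section
/- For every n ≥ 3, the type D Eulerian polynomial satisfies Σ_{σ ∈ D_n} t^{des_D(σ)} = Σ_{ŵ ∈ Des_n^D} t^{pk(ŵ)} (1+t)^{n−2·pk(ŵ)} as polynomials in t. -/
open Polynomial Finset

attribute [local instance] Classical.propDecidable

/-- The set of peaks of `0w`: positions `i ∈ [n-1]` with `w_{i-1} < w_i > w_{i+1}`
(where `w_0 = 0`). -/
def pkSet (n : ℕ) (w : Equiv.Perm (Fin n)) : Finset ℕ :=
  (Finset.Icc 1 (n - 1)).filter fun i =>
    pval n w (i - 1) < pval n w i ∧ pval n w (i + 1) < pval n w i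

/-- `pk(0w)`, the number of peaks of `0w`. -/
def pk (n : ℕ) (w : Equiv.Perm (Fin n)) : ℕ := (pkSet n w).card

/-- A signed permutation, encoded as an (unsigned) permutation together with a sign
for each position, evaluated as an integer sequence `σ(1), …, σ(n)` (one-indexed,
with value `0` outside the range). -/
def sval (n : ℕ) (σ : Equiv.Perm (Fin n) × (Fin n → Bool)) (i : ℕ) : ℤ :=
  if h : 1 ≤ i ∧ i ≤ n then
    (if σ.2 ⟨i - 1, by omega⟩ then -(((σ.1 ⟨i - 1, by omega⟩ : Fin n) : ℕ) + 1 : ℤ)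
     else (((σ.1 ⟨i - 1, by omega⟩ : Fin n) : ℕ) + 1 : ℤ))
  else 0

/-- A signed permutation is in `D_n` iff it has an even number of negative entries. -/
def IsEvenSigned (n : ℕ) (σ : Equiv.Perm (Fin n) × (Fin n → Bool)) : Prop :=
  (Finset.univ.filter fun j : Fin n => σ.2 j = true).card % 2 = 0

/-- The value sequence used for type D descents: `σ(0) := -σ(2)` and `σ(i)` for `i ≥ 1`. -/
def dval (n : ℕ) (σ : Equiv.Perm (Fin n) × (Fin n → Bool)) (i : ℕ) : ℤ :=
  if i = 0 then -sval n σ 2 else sval n σ i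

/-- The type D descent number: `des_D(σ) = #{i ∈ {0,…,n-1} : σ(i) > σ(i+1)}`,
with `σ(0) := -σ(2)`. -/
def desD (n : ℕ) (σ : Equiv.Perm (Fin n) × (Fin n → Bool)) : ℕ :=
  ((Finset.range n).filter fun i => dval n σ (i + 1) < dval n σ i).card

/-- A decorated permutation of `[n]`: a permutation together with a color in
`{0,1,2,3}` (i.e. `Fin 4`) for each peak of `0w`, the color being `0` away from peaks. -/
def IsDecorated (n : ℕ) (p : Equiv.Perm (Fin n) × (Fin n → Fin 4)) : Prop :=
  ∀ j : Fin n, (j : ℕ) ∉ pkSet n p.1 → p.2 j = 0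

/-- Membership in `Des_n^D`: a decorated permutation `(w, c)` such that either
`w_1 < w_2 < w_3`, or both `max{w_1,w_2,w_3} ≠ w_3` and the color of the first bar
(the bar at the smallest peak position) lies in `{0,1}`. -/
def InDesD (n : ℕ) (p : Equiv.Perm (Fin n) × (Fin n → Fin 4)) : Prop :=
  IsDecorated n p ∧
  ((pval n p.1 1 < pval n p.1 2 ∧ pval n p.1 2 < pval n p.1 3) ∨
    ((pval n p.1 3 < pval n p.1 1 ∨ pval n p.1 3 < pval n p.1 2) ∧
      ∀ j : Fin n, (j : ℕ) ∈ pkSet n p.1 → (∀ q ∈ pkSet n p.1, (j : ℕ) ≤ q) →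
        (p.2 j = 0 ∨ p.2 j = 1)))

/-- Ascents of `0 w_1 ⋯ w_n ∞`. -/
def IsAsc (n : ℕ) (w : Equiv.Perm (Fin n)) (i : ℕ) : Prop :=
  i = n ∨ pval n w i < pval n w (i + 1)

/-- The sign-sum of one letter whose left and right neighbouring steps are ascents
iff `u`, resp. `v`, holds. -/
noncomputable def letterFactor (u v : Prop) : ℤ[X] :=
  X ^ (if u then 1 else 0) + X ^ (if v then 0 else 1)

theorem prod_letterFactor (u : ℕ → Prop) (h0 : u 0) (m p : ℕ)
    (hp : p = ∑ i ∈ range m, if u i ∧ ¬ u (i + 1) then 1 else 0) :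
    (u m → 2 * p ≤ m ∧ ∏ i ∈ range m, letterFactor (u i) (u (i + 1)) =
      4 ^ p * (X ^ p * (1 + X) ^ (m - 2 * p))) ∧
    (¬ u m → 2 * p ≤ m + 1 ∧ 2 * ∏ i ∈ range m, letterFactor (u i) (u (i + 1)) =
      4 ^ p * (X ^ p * (1 + X) ^ (m + 1 - 2 * p))) := by
  induction m generalizing p with
  | zero => simp_all
  | succ m ih =>
    rw [sum_range_succ] at hp
    obtain ⟨ih1, ih2⟩ := ih _ rfl
    set q := ∑ i ∈ range m, if u i ∧ ¬ u (i + 1) then 1 else 0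
    by_cases hm : u m <;> by_cases hm' : u (m + 1) <;>
      simp only [hm, hm', not_true_eq_false, not_false_eq_true, and_false, and_true, if_true,
        if_false, add_zero, forall_true_left, IsEmpty.forall_iff, true_and,
        prod_range_succ, letterFactor, pow_zero, pow_one] at hp ih1 ih2 ⊢ <;> subst hp
    · obtain ⟨hle, h⟩ := ih1
      refine ⟨by omega, ?_⟩
      rw [h, show m + 1 - 2 * q = m - 2 * q + 1 by omega]
      ring
    · obtain ⟨hle, h⟩ := ih1
      refine ⟨by omega, ?_⟩
      rw [h, show m + 1 + 1 - 2 * (q + 1) = m - 2 * q by omega]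
      ring
    · obtain ⟨hle, h⟩ := ih2
      refine ⟨by omega, ?_⟩
      linear_combination h
    · obtain ⟨hle, h⟩ := ih2
      refine ⟨by omega, ?_⟩
      rw [show m + 1 + 1 - 2 * q = m + 1 - 2 * q + 1 by omega]
      linear_combination (1 + X) * h

theorem pval_pos {n : ℕ} (w : Equiv.Perm (Fin n)) {i : ℕ} (h : i < n) :
    0 < pval n w (i + 1) := by
  rw [pval, dif_pos (by omega)]
  omega

theorem pval_injOn {n : ℕ} (w : Equiv.Perm (Fin n)) {i j : ℕ} (hi : i < n) (hj : j < n)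
    (h : pval n w (i + 1) = pval n w (j + 1)) : i = j := by
  rw [pval, pval, dif_pos (by omega), dif_pos (by omega)] at h
  have := w.injective (Fin.ext (Nat.succ_injective h))
  simpa using this

theorem mem_pkSet_succ {n : ℕ} (w : Equiv.Perm (Fin n)) {k : ℕ} (hk : k < n) :
    k + 1 ∈ pkSet n w ↔ IsAsc n w k ∧ ¬ IsAsc n w (k + 1) := by
  simp only [pkSet, mem_filter, mem_Icc, IsAsc, add_tsub_cancel_right]
  by_cases h : k + 1 = n
  · simp only [h, true_or, not_true_eq_false, and_false, iff_false]
    omega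
  · have : pval n w (k + 1) ≠ pval n w (k + 1 + 1) := fun e => by
      have := pval_injOn w hk (by omega) e
      omega
    omega

theorem pk_eq_sum (n : ℕ) (w : Equiv.Perm (Fin n)) :
    pk n w = ∑ i ∈ range n, if IsAsc n w i ∧ ¬ IsAsc n w (i + 1) then 1 else 0 := by
  rw [← card_filter, pk]
  symm
  refine card_nbij (· + 1) ?_ ?_ ?_
  · intro k hk
    rw [mem_coe, mem_filter, mem_range] at hk
    exact (mem_pkSet_succ w hk.1).2 hk.2
  · intro a _ b _ h
    exact Nat.succ_injective h
  · intro k hk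
    have h := hk
    simp only [pkSet, coe_filter, mem_Icc, Set.mem_ofPred_eq] at h
    obtain ⟨k, rfl⟩ : ∃ j, k = j + 1 := ⟨k - 1, by omega⟩
    refine ⟨k, ?_, rfl⟩
    simp only [coe_filter, mem_range, Set.mem_ofPred_eq]
    exact ⟨by omega, (mem_pkSet_succ w (by omega)).1 hk⟩

/-- The type B sign-sum over a fixed underlying permutation. -/
theorem prod_isAsc (n : ℕ) (hn : 0 < n) (w : Equiv.Perm (Fin n)) :
    ∏ i ∈ range n, letterFactor (IsAsc n w i) (IsAsc n w (i + 1)) =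
      4 ^ pk n w * (X ^ pk n w * (1 + X) ^ (n - 2 * pk n w)) := by
  refine ((prod_letterFactor (IsAsc n w) (Or.inr ?_) n _ (pk_eq_sum n w)).1 (Or.inl rfl)).2
  simpa [pval] using pval_pos w hn

/-- The sign of the letter with zero-based index `i`. -/
def signAt (n : ℕ) (e : Fin n → Bool) (i : ℕ) : Bool :=
  if h : i < n then e ⟨i, h⟩ else false

theorem sval_succ {n : ℕ} (w : Equiv.Perm (Fin n)) (e : Fin n → Bool) {i : ℕ} (h : i < n) :
    sval n (w, e) (i + 1) =
      if signAt n e i then -(pval n w (i + 1) : ℤ) else pval n w (i + 1) := by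
  have hi : 1 ≤ i + 1 ∧ i + 1 ≤ n := by omega
  simp [sval, pval, signAt, h, hi]

theorem dval_succ_lt_iff {n : ℕ} (w : Equiv.Perm (Fin n)) (e : Fin n → Bool) {i : ℕ}
    (h : i + 1 < n) :
    dval n (w, e) (i + 1 + 1) < dval n (w, e) (i + 1) ↔
      (IsAsc n w (i + 1) ∧ signAt n e (i + 1) = true) ∨
        (¬ IsAsc n w (i + 1) ∧ ¬ signAt n e i = true) := by
  have h1 := pval_pos w (show i < n by omega)
  have h2 := pval_pos w h
  have h3 : pval n w (i + 1) ≠ pval n w (i + 1 + 1) := fun e => by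
    have := pval_injOn w (by omega) h e
    omega
  simp only [dval, Nat.add_eq_zero_iff, one_ne_zero, and_false, if_false, sval_succ w e h,
    sval_succ w e (show i < n by omega), IsAsc, h.ne, false_or]
  split_ifs <;> simp_all <;> omega

theorem dval_one_lt_iff {n : ℕ} (w : Equiv.Perm (Fin n)) (e : Fin n → Bool) (h : 1 < n) :
    dval n (w, e) 1 < dval n (w, e) 0 ↔
      (IsAsc n w 1 ∧ signAt n e 1 = true) ∨ (¬ IsAsc n w 1 ∧ signAt n e 0 = true) := by
  have h1 := pval_pos w (show 0 < n by omega)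
  have h2 := pval_pos w h
  have h3 : pval n w (0 + 1) ≠ pval n w (1 + 1) := fun e => by
    have := pval_injOn w (by omega) h e
    omega
  have e1 := sval_succ w e h
  have e0 := sval_succ w e (show 0 < n by omega)
  norm_num at e0 e1 h1 h2 h3
  simp only [dval, one_ne_zero, if_false, if_true, e0, e1, IsAsc, h.ne, false_or, Nat.reduceAdd]
  split_ifs <;> simp_all <;> omega

/-- The number of type D descents attributed to the letter of index `j` with sign `b`, when
the ascents of the underlying permutation are given by `u`. -/
noncomputable def letterDes (u : ℕ → Prop) : ℕ → Bool → ℕ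
  | 0, _ => if u 1 then 0 else 1
  | 1, b => 2 * (if u 1 ∧ b = true then 1 else 0) + if ¬ u 2 ∧ ¬ b = true then 1 else 0
  | j + 2, b => (if u (j + 2) ∧ b = true then 1 else 0) +
      if ¬ u (j + 3) ∧ ¬ b = true then 1 else 0

theorem desD_eq_sum (m : ℕ) (w : Equiv.Perm (Fin (m + 3))) (e : Fin (m + 3) → Bool) :
    desD (m + 3) (w, e) = ∑ j : Fin (m + 3), letterDes (IsAsc (m + 3) w) j (e j) := by
  have key : ∑ j : Fin (m + 3), letterDes (IsAsc (m + 3) w) j (e j) =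
      ∑ j ∈ range (m + 3), letterDes (IsAsc (m + 3) w) j (signAt (m + 3) e j) := by
    rw [sum_range]
    simp [signAt]
  have hlast : IsAsc (m + 3) w (m + 3) := Or.inl rfl
  rw [key, desD, card_filter, sum_range_succ', sum_range_succ', sum_range_succ' _ (m + 2),
    sum_range_succ' _ (m + 1)]
  have hsum : ∑ i ∈ range (m + 1), (if dval (m + 3) (w, e) (i + 1 + 1 + 1) <
      dval (m + 3) (w, e) (i + 1 + 1) then 1 else 0) =
      ∑ i ∈ range (m + 1), ((if IsAsc (m + 3) w (i + 2) ∧ signAt (m + 3) e (i + 2) = true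
        then 1 else 0) + if ¬ IsAsc (m + 3) w (i + 2) ∧ ¬ signAt (m + 3) e (i + 1) = true
        then 1 else 0) := by
    refine sum_congr rfl fun i hi => ?_
    rw [mem_range] at hi
    simp only [dval_succ_lt_iff w e (show i + 1 + 1 < m + 3 by omega)]
    by_cases h : IsAsc (m + 3) w (i + 2) <;> simp [h]
  rw [hsum]
  simp only [letterDes, sum_add_distrib, zero_add]
  rw [sum_range_succ' (fun i => if ¬ IsAsc (m + 3) w (i + 2) ∧ _ then 1 else 0),
    sum_range_succ (fun i => if ¬ IsAsc (m + 3) w (i + 3) ∧ _ then 1 else 0)]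
  have h1 := dval_succ_lt_iff w e (show 0 + 1 < m + 3 by omega)
  have h0 := dval_one_lt_iff w e (show 1 < m + 3 by omega)
  simp only [zero_add, Nat.reduceAdd] at h0 h1
  simp only [h0, h1, hlast, not_true_eq_false, false_and, if_false, zero_add,
    Nat.reduceAdd, add_assoc]
  by_cases hu : IsAsc (m + 3) w 1 <;> by_cases hs : signAt (m + 3) e 0 = true <;>
    by_cases hs' : signAt (m + 3) e 1 = true <;> simp [hu, hs, hs']

theorem two_mul_sum_even {R : Type*} [CommRing R] (m : ℕ) (f : (Fin (m + 1) → Bool) → R)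
    (hf : ∀ e b, f (Function.update e 0 b) = f e) (w : Equiv.Perm (Fin (m + 1))) :
    2 * ∑ e ∈ univ.filter (fun e => IsEvenSigned (m + 1) (w, e)), f e = ∑ e, f e := by
  rw [← sum_filter_add_sum_filter_not univ (fun e => IsEvenSigned (m + 1) (w, e)), two_mul]
  congr 1
  have hflip : ∀ e : Fin (m + 1) → Bool,
      IsEvenSigned (m + 1) (w, Function.update e 0 (!e 0)) ↔ ¬ IsEvenSigned (m + 1) (w, e) := by
    intro e
    simp only [IsEvenSigned, card_filter, Fin.sum_univ_succ, Function.update_self,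
      Function.update_of_ne (Fin.succ_ne_zero _)]
    cases e 0 <;> simp <;> omega
  refine sum_nbij' (fun e => Function.update e 0 (!e 0)) (fun e => Function.update e 0 (!e 0))
    ?_ ?_ ?_ ?_ ?_
  · intro e he
    simp only [mem_filter, mem_univ, true_and] at he ⊢
    rw [hflip]
    simpa using he
  · intro e he
    simp only [mem_filter, mem_univ, true_and] at he ⊢
    rw [hflip]
    simpa using he
  · intro e _
    simp
  · intro e _
    simp
  · intro e _
    exact (hf _ _).symm

/-- The contribution of the letters of index at least two. -/
noncomputable def tailFactor (n : ℕ) (w : Equiv.Perm (Fin n)) : ℤ[X] :=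
  ∏ i ∈ range (n - 2), letterFactor (IsAsc n w (i + 2)) (IsAsc n w (i + 3))

theorem two_mul_sum_desD (m : ℕ) (w : Equiv.Perm (Fin (m + 3))) :
    2 * ∑ e ∈ univ.filter (fun e => IsEvenSigned (m + 3) (w, e)),
      (X : ℤ[X]) ^ desD (m + 3) (w, e) =
    2 * X ^ (if IsAsc (m + 3) w 1 then 0 else 1) *
      (X ^ (if IsAsc (m + 3) w 1 then 2 else 0) + X ^ (if IsAsc (m + 3) w 2 then 0 else 1)) *
      tailFactor (m + 3) w := by
  rw [two_mul_sum_even (m + 2)]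
  · simp only [desD_eq_sum, ← prod_pow_eq_pow_sum]
    rw [← Fintype.piFinset_univ, ← prod_univ_sum (fun _ => univ)
      (fun (j : Fin (m + 3)) b => (X : ℤ[X]) ^ letterDes (IsAsc (m + 3) w) j b),
      ← prod_range (fun j => ∑ b, (X : ℤ[X]) ^ letterDes (IsAsc (m + 3) w) j b),
      prod_range_succ', prod_range_succ']
    have : ∀ i, ∑ b, (X : ℤ[X]) ^ letterDes (IsAsc (m + 3) w) (i + 1 + 1) b =
        letterFactor (IsAsc (m + 3) w (i + 2)) (IsAsc (m + 3) w (i + 3)) := by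
      intro i
      by_cases h1 : IsAsc (m + 3) w (i + 2) <;> by_cases h2 : IsAsc (m + 3) w (i + 3) <;>
        simp [letterDes, letterFactor, h1, h2, one_add_one_eq_two]
    simp only [this, tailFactor, show m + 3 - 2 = m + 1 by omega]
    by_cases h1 : IsAsc (m + 3) w 1 <;> by_cases h2 : IsAsc (m + 3) w 2 <;>
      simp [letterDes, h1, h2] <;> ring
  · intro e b
    simp only [desD_eq_sum, Fin.sum_univ_succ (n := m + 2), Function.update_self,
      Function.update_of_ne (Fin.succ_ne_zero _), Fin.val_zero, letterDes]

theorem prod_isAsc_eq_tailFactor (m : ℕ) (w : Equiv.Perm (Fin (m + 3))) :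
    4 ^ pk (m + 3) w * (X ^ pk (m + 3) w * (1 + X) ^ (m + 3 - 2 * pk (m + 3) w)) =
    (X + X ^ (if IsAsc (m + 3) w 1 then 0 else 1)) *
      letterFactor (IsAsc (m + 3) w 1) (IsAsc (m + 3) w 2) * tailFactor (m + 3) w := by
  have h0 : IsAsc (m + 3) w 0 := Or.inr (by simp [pval])
  rw [← prod_isAsc _ (by omega), prod_range_succ', prod_range_succ', tailFactor,
    show m + 3 - 2 = m + 1 by omega]
  simp only [letterFactor, h0, if_true, zero_add, pow_one, Nat.reduceAdd, add_assoc]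
  ring

theorem card_filter_mem_pkSet (n : ℕ) (w : Equiv.Perm (Fin n)) :
    (univ.filter fun j : Fin n => (j : ℕ) ∈ pkSet n w).card = pk n w := by
  rw [pk]
  refine card_nbij (fun j => (j : ℕ)) ?_ ?_ ?_
  · intro j hj
    simpa using hj
  · intro a _ b _ h
    exact Fin.ext h
  · intro k hk
    have h := hk
    simp only [pkSet, coe_filter, mem_Icc, Set.mem_ofPred_eq] at h
    exact ⟨⟨k, by omega⟩, by simpa using hk, rfl⟩

theorem prod_card_colors (n : ℕ) (w : Equiv.Perm (Fin n)) :
    ∏ j : Fin n, (if (j : ℕ) ∈ pkSet n w then (univ : Finset (Fin 4)) else {0}).card =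
      4 ^ pk n w := by
  rw [← card_filter_mem_pkSet, ← prod_const, prod_filter]
  refine prod_congr rfl fun j _ => ?_
  split_ifs <;> simp

theorem card_isDecorated (n : ℕ) (w : Equiv.Perm (Fin n)) :
    #{c : Fin n → Fin 4 | IsDecorated n (w, c)} = 4 ^ pk n w := by
  rw [← prod_card_colors, ← Fintype.card_piFinset]
  congr 1
  ext c
  rw [mem_filter, Fintype.mem_piFinset]
  simp only [mem_univ, true_and, IsDecorated]
  refine forall_congr' fun j => ?_
  split_ifs with h <;> simp [h]

theorem two_mul_card_first_color (n : ℕ) (w : Equiv.Perm (Fin n)) (hne : (pkSet n w).Nonempty) :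
    2 * (univ.filter fun c : Fin n → Fin 4 => IsDecorated n (w, c) ∧
      ∀ j : Fin n, (j : ℕ) ∈ pkSet n w → (∀ q ∈ pkSet n w, (j : ℕ) ≤ q) →
        (c j = 0 ∨ c j = 1)).card = 4 ^ pk n w := by
  obtain ⟨k, hk, hmin⟩ := (pkSet n w).exists_min_image id hne
  have hkn : k < n := by
    have h := hk
    simp only [pkSet, mem_filter, mem_Icc] at h
    omega
  let a : Fin n := ⟨k, hkn⟩
  have hpi : (univ.filter fun c : Fin n → Fin 4 => IsDecorated n (w, c) ∧
      ∀ j : Fin n, (j : ℕ) ∈ pkSet n w → (∀ q ∈ pkSet n w, (j : ℕ) ≤ q) →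
        (c j = 0 ∨ c j = 1)) =
      Fintype.piFinset fun j : Fin n => if j = a then ({0, 1} : Finset (Fin 4)) else
        if (j : ℕ) ∈ pkSet n w then univ else {0} := by
    ext c
    rw [mem_filter, Fintype.mem_piFinset]
    simp only [mem_univ, true_and, IsDecorated]
    rw [← forall_and]
    refine forall_congr' fun j => ?_
    by_cases hj : j = a
    · subst hj
      have ha : ((a : Fin n) : ℕ) ∈ pkSet n w := hk
      have hm : ∀ q ∈ pkSet n w, ((a : Fin n) : ℕ) ≤ q := hmin
      simp [ha, imp_iff_right hm]
    · have hm : (j : ℕ) ∈ pkSet n w → ¬ ∀ q ∈ pkSet n w, (j : ℕ) ≤ q := fun h h' =>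
        hj (Fin.ext (le_antisymm (h' k hk) (hmin j h)))
      by_cases h : (j : ℕ) ∈ pkSet n w
      · simp only [h, hj, hm h, not_true_eq_false, if_true, if_false, mem_univ]
        simp
      · simp [h, hj]
  rw [hpi, Fintype.card_piFinset, ← prod_card_colors, ← mul_prod_erase univ _ (mem_univ a),
    ← mul_prod_erase univ (fun j : Fin n => (if (j : ℕ) ∈ pkSet n w then _ else _ : Finset _).card)
      (mem_univ a), ← mul_assoc]
  congr 1
  · have ha : ((a : Fin n) : ℕ) ∈ pkSet n w := hk
    simp [ha]
  · refine prod_congr rfl fun j hj => ?_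
    rw [if_neg (ne_of_mem_erase hj)]

/-- Twice the difference of the two sides of the type D expansion over a fixed permutation. -/
noncomputable def defect (n : ℕ) (w : Equiv.Perm (Fin n)) : ℤ[X] :=
  if pval n w 1 < pval n w 3 ∧ pval n w 2 < pval n w 3 then
    (if pval n w 1 < pval n w 2 then -(4 * X * tailFactor n w) else 4 * X * tailFactor n w)
  else 0

theorem two_mul_sum_desD_sub (m : ℕ) (w : Equiv.Perm (Fin (m + 3))) :
    2 * (∑ e ∈ univ.filter (fun e => IsEvenSigned (m + 3) (w, e)),
      (X : ℤ[X]) ^ desD (m + 3) (w, e) -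
    ∑ _c ∈ univ.filter (fun c => InDesD (m + 3) (w, c)),
      (X : ℤ[X]) ^ pk (m + 3) w * (1 + X) ^ (m + 3 - 2 * pk (m + 3) w)) =
    defect (m + 3) w := by
  have hB := prod_isAsc_eq_tailFactor m w
  have hp := card_isDecorated (m + 3) w
  have hq := two_mul_card_first_color (m + 3) w
  have hk1 := mem_pkSet_succ w (k := 0) (by omega)
  have hk2 := mem_pkSet_succ w (k := 1) (by omega)
  have h0 : IsAsc (m + 3) w 0 := Or.inr (by simp [pval])
  have h12 : pval (m + 3) w 1 ≠ pval (m + 3) w 2 := fun e => by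
    have := pval_injOn w (i := 0) (j := 1) (by omega) (by omega) e
    omega
  have h13 : pval (m + 3) w 1 ≠ pval (m + 3) w 3 := fun e => by
    have := pval_injOn w (i := 0) (j := 2) (by omega) (by omega) e
    omega
  have h23 : pval (m + 3) w 2 ≠ pval (m + 3) w 3 := fun e => by
    have := pval_injOn w (i := 1) (j := 2) (by omega) (by omega) e
    omega
  have a1 : IsAsc (m + 3) w 1 ↔ pval (m + 3) w 1 < pval (m + 3) w 2 := by simp [IsAsc]
  have a2 : IsAsc (m + 3) w 2 ↔ pval (m + 3) w 2 < pval (m + 3) w 3 := by simp [IsAsc]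
  rw [mul_sub, two_mul_sum_desD, sum_const, nsmul_eq_mul]
  simp only [zero_add, Nat.reduceAdd, h0, true_and] at hk1 hk2
  simp only [letterFactor] at hB
  set P := (X : ℤ[X]) ^ pk (m + 3) w * (1 + X) ^ (m + 3 - 2 * pk (m + 3) w)
  by_cases hmax : pval (m + 3) w 3 < pval (m + 3) w 1 ∨ pval (m + 3) w 3 < pval (m + 3) w 2
  · have hnot : ¬ (pval (m + 3) w 1 < pval (m + 3) w 2 ∧
        pval (m + 3) w 2 < pval (m + 3) w 3) := by omega
    have hne : (pkSet (m + 3) w).Nonempty := by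
      by_cases h : IsAsc (m + 3) w 1
      · exact ⟨2, hk2.2 ⟨h, by rw [a1] at h; rw [a2]; omega⟩⟩
      · exact ⟨1, hk1.2 h⟩
    specialize hq hne
    simp only [InDesD, hnot, hmax, false_or, true_and]
    have hq' := congrArg (Nat.cast : ℕ → ℤ[X]) hq
    push_cast at hq'
    have hdef : defect (m + 3) w = 0 := if_neg (by omega)
    rw [hdef, ← mul_assoc, hq', hB]
    by_cases h1 : IsAsc (m + 3) w 1
    · have h2 : ¬ IsAsc (m + 3) w 2 := by rw [a1] at h1; rw [a2]; omega
      simp [h1, h2]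
      ring
    · by_cases h2 : IsAsc (m + 3) w 2 <;> simp [h1, h2] <;> ring
  · have h2 : IsAsc (m + 3) w 2 := by rw [a2]; omega
    have hdef : defect (m + 3) w = if pval (m + 3) w 1 < pval (m + 3) w 2 then
        -(4 * X * tailFactor (m + 3) w) else 4 * X * tailFactor (m + 3) w := if_pos (by omega)
    rw [hdef]
    by_cases h1 : IsAsc (m + 3) w 1
    · have h1' := a1.1 h1
      simp only [InDesD, h1', a2.1 h2, and_self, true_or, and_true]
      rw [hp]
      push_cast
      rw [hB]
      simp [h1, h2]
      ring
    · have h1' := mt a1.2 h1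
      simp only [InDesD, h1', hmax, false_and, false_or, and_false, if_false]
      simp only [h1, h2, if_true, if_false, filter_false, card_empty, Nat.cast_zero, pow_zero,
        pow_one, zero_mul]
      ring

/-- Exchanging the first two letters. -/
def swapFirst (m : ℕ) (w : Equiv.Perm (Fin (m + 3))) : Equiv.Perm (Fin (m + 3)) :=
  w * Equiv.swap 0 1

theorem pval_swapFirst_one (m : ℕ) (w : Equiv.Perm (Fin (m + 3))) :
    pval (m + 3) (swapFirst m w) 1 = pval (m + 3) w 2 := by
  have h1 : (⟨1, by omega⟩ : Fin (m + 3)) = 1 := rfl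
  simp [pval, swapFirst, h1]

theorem pval_swapFirst_two (m : ℕ) (w : Equiv.Perm (Fin (m + 3))) :
    pval (m + 3) (swapFirst m w) 2 = pval (m + 3) w 1 := by
  have h1 : (⟨1, by omega⟩ : Fin (m + 3)) = 1 := rfl
  simp [pval, swapFirst, h1]

theorem pval_swapFirst_add_three (m : ℕ) (w : Equiv.Perm (Fin (m + 3))) (i : ℕ) :
    pval (m + 3) (swapFirst m w) (i + 3) = pval (m + 3) w (i + 3) := by
  unfold pval
  split_ifs with h
  · rw [swapFirst, Equiv.Perm.mul_apply, Equiv.swap_apply_of_ne_of_ne] <;>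
      simp [Fin.ext_iff]
  · rfl

theorem defect_swapFirst (m : ℕ) (w : Equiv.Perm (Fin (m + 3))) :
    defect (m + 3) w + defect (m + 3) (swapFirst m w) = 0 := by
  have h12 : pval (m + 3) w 1 ≠ pval (m + 3) w 2 := fun e => by
    have := pval_injOn w (i := 0) (j := 1) (by omega) (by omega) e
    omega
  have h3 := pval_swapFirst_add_three m w 0
  simp only [zero_add] at h3
  simp only [defect, pval_swapFirst_one, pval_swapFirst_two, h3]
  by_cases h : pval (m + 3) w 1 < pval (m + 3) w 3 ∧ pval (m + 3) w 2 < pval (m + 3) w 3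
  · have hasc : ∀ i, IsAsc (m + 3) (swapFirst m w) (i + 2) ↔ IsAsc (m + 3) w (i + 2) := by
      rintro (_ | i)
      · simp [IsAsc, h3, pval_swapFirst_two, h]
      · simp only [IsAsc, show i + 1 + 2 = i + 3 by omega, show i + 3 + 1 = (i + 1) + 3 by omega,
          pval_swapFirst_add_three]
    have htail : tailFactor (m + 3) (swapFirst m w) = tailFactor (m + 3) w := by
      refine prod_congr rfl fun i _ => ?_
      rw [propext (hasc i), propext (hasc (i + 1))]
    rw [if_pos h, if_pos h.symm, htail]
    rcases lt_or_gt_of_ne h12 with h' | h'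
    · rw [if_pos h', if_neg (by omega)]
      ring
    · rw [if_neg (by omega), if_pos h']
      ring
  · rw [if_neg h, if_neg (by tauto), add_zero]

theorem sum_defect (m : ℕ) : ∑ w, defect (m + 3) w = 0 := by
  refine sum_involution (fun w _ => swapFirst m w) (fun w _ => defect_swapFirst m w) ?_
    (fun _ _ => mem_univ _) ?_
  · intro w _ _ h
    have := pval_swapFirst_one m w
    rw [h] at this
    have := pval_injOn w (i := 0) (j := 1) (by omega) (by omega) this
    omega
  · intro w _
    simp [swapFirst, mul_assoc]

/-- Stembridge: the type `D_n` Eulerian polynomial satisfies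
`Σ_{σ ∈ D_n} t^{des_D σ} = Σ_{ŵ ∈ Des_n^D} t^{pk ŵ} (1+t)^{n-2 pk ŵ}`. -/
theorem typeD_gamma (n : ℕ) (hn : 3 ≤ n) :
    ∑ σ ∈ Finset.univ.filter
        fun σ : Equiv.Perm (Fin n) × (Fin n → Bool) => IsEvenSigned n σ,
      (X : Polynomial ℤ) ^ desD n σ =
    ∑ p ∈ Finset.univ.filter
        fun p : Equiv.Perm (Fin n) × (Fin n → Fin 4) => InDesD n p,
      (X : Polynomial ℤ) ^ pk n p.1 * (1 + X) ^ (n - 2 * pk n p.1) := by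
  obtain ⟨m, rfl⟩ : ∃ m, n = m + 3 := ⟨n - 3, by omega⟩
  rw [← sub_eq_zero]
  refine (mul_eq_zero.1 ?_).resolve_left (two_ne_zero (α := ℤ[X]))
  rw [← sum_defect m, sum_filter, sum_filter, Fintype.sum_prod_type, Fintype.sum_prod_type,
    ← sum_sub_distrib, mul_sum]
  refine sum_congr rfl fun w _ => ?_
  rw [← two_mul_sum_desD_sub, sum_filter, sum_filter]
end
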